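/- Let n be a positive integer, let p₁ and p₂ be distinct primes both dividing n, let q be a prime power, and let V = F_q^n. Then every invertible linear map X of V satisfies at least one of the following: (a) X stabilizes a subspace of V of dimension k with 1 ≤ k < n/2, p₁ ∤ k and p₂ ∤ k; (b) there exists an F_{q^{p₁}}-vector space structure on V extending the F_q-structure with respect to which X is F_{q^{p₁}}-linear; (c) there exists an F_{q^{p₂}}-vector space structure on V extending the F_q-structure with respect to which X is F_{q^{p₂}}-linear. -/

import Mathlib

/-- An `F_{q^p}`-vector space structure on `V` (given by a field `K` with `m` elements)
extending the `F`-structure, with respect to which the map `X` is `K`-linear. -/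
structure ExtScalarStructure (m : ℕ) (F : Type*) [Field F] (V : Type*) [AddCommGroup V]
    [Module F V] (X : V → V) where
  K : Type
  [fieldK : Field K]
  [fintypeK : Fintype K]
  cardK : Fintype.card K = m
  [moduleK : Module K V]
  ι : F →+* K
  compat : ∀ (c : F) (v : V), ι c • v = c • v
  linearX : ∀ (c : K) (v : V), X (c • v) = c • X v

open Polynomial in
/-- If `f(T)` has nontrivial kernel, for an irreducible polynomial `f`, then this kernel contains a
`T`-invariant subspace of dimension the degree of `f`. -/
theorem Module.End.exists_invariant_finrank_eq_natDegree {F V : Type*} [Field F] [AddCommGroup V]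
    [Module F V] (T : Module.End F V) {f : F[X]} (hf : Irreducible f)
    (hker : LinearMap.ker (aeval T f) ≠ ⊥) :
    ∃ U : Submodule F V, U ≤ LinearMap.ker (aeval T f) ∧ (∀ v ∈ U, T v ∈ U) ∧
      Module.finrank F U = f.natDegree := by
  obtain ⟨v, hv, hv0⟩ := Submodule.exists_mem_ne_zero_of_ne_bot hker
  rw [LinearMap.mem_ker] at hv
  let φ : F[X] →ₗ[F] V := (LinearMap.applyₗ v).comp (aeval T).toLinearMap
  have hφ (p : F[X]) : φ p = aeval T p v := rfl
  have hmul (p q : F[X]) : φ (p * q) = aeval T p (φ q) := by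
    simp [hφ]
  have hφker : LinearMap.ker φ = (Ideal.span {f}).restrictScalars F := by
    ext p
    rw [LinearMap.mem_ker, Submodule.restrictScalars_mem, Ideal.mem_span_singleton]
    constructor
    · intro hp
      by_contra hfp
      obtain ⟨a, b, hab⟩ := (hf.coprime_iff_not_dvd).2 hfp
      apply hv0
      have h1 : φ 1 = v := by simp [hφ]
      rw [← h1, ← hab, map_add, hmul, hmul, hp, hφ f, hv]
      simp
    · rintro ⟨c, rfl⟩
      rw [mul_comm, hmul, hφ, hv, map_zero]
  refine ⟨LinearMap.range φ, ?_, ?_, ?_⟩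
  · rintro _ ⟨p, rfl⟩
    rw [LinearMap.mem_ker, ← hmul, mul_comm, hmul, hφ f, hv, map_zero]
  · rintro _ ⟨p, rfl⟩
    exact ⟨X * p, by rw [hmul, aeval_X]⟩
  · rw [← φ.quotKerEquivRange.finrank_eq, hφker]
    exact finrank_quotient_span_eq_natDegree

open Polynomial in
theorem Module.End.ker_aeval_ne_bot_of_dvd_minpoly {F V : Type*} [Field F] [AddCommGroup V]
    [Module F V] [FiniteDimensional F V] (T : Module.End F V) {f : F[X]} (hf : Irreducible f)
    (hdvd : f ∣ minpoly F T) : LinearMap.ker (aeval T f) ≠ ⊥ := by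
  intro hbot
  obtain ⟨g, hg⟩ := hdvd
  have hm0 : minpoly F T ≠ 0 := minpoly.ne_zero (Algebra.IsIntegral.isIntegral T)
  have hg0 : g ≠ 0 := by
    rintro rfl
    exact hm0 (by rw [hg, mul_zero])
  have h0 : aeval T g = 0 := by
    ext v
    apply LinearMap.ker_eq_bot.1 hbot
    have : aeval T (f * g) v = 0 := by rw [← hg, minpoly.aeval, LinearMap.zero_apply]
    simpa using this
  have hle := natDegree_le_of_dvd (minpoly.dvd F T h0) hg0
  rw [hg, natDegree_mul hf.ne_zero hg0] at hle
  have := hf.natDegree_pos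
  omega

open Polynomial in
theorem LinearMap.aeval_dualMap {F V : Type*} [Field F] [AddCommGroup V] [Module F V]
    (T : Module.End F V) (f : F[X]) :
    aeval (T.dualMap : Module.End F (Module.Dual F V)) f = (aeval T f).dualMap := by
  induction f using Polynomial.induction_on' with
  | add p q hp hq =>
    rw [map_add, map_add, hp, hq]
    ext φ v
    simp
  | monomial k a =>
    have hpow : (T.dualMap : Module.End F (Module.Dual F V)) ^ k = (T ^ k).dualMap := by
      induction k with
      | zero => rfl
      | succ k ih => rw [pow_succ, ih, pow_succ']; rfl
    ext φ v
    simp [aeval_monomial, hpow, Module.algebraMap_end_apply]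

theorem LinearMap.ker_dualMap_ne_bot {F V : Type*} [Field F] [AddCommGroup V] [Module F V]
    [FiniteDimensional F V] (T : Module.End F V) (h : LinearMap.ker T ≠ ⊥) :
    LinearMap.ker T.dualMap ≠ ⊥ := by
  rw [Ne, LinearMap.ker_eq_bot] at h ⊢
  rwa [LinearMap.dualMap_injective_iff, ← LinearMap.injective_iff_surjective]

/-- The dual coannihilator of a subspace invariant under the transpose is invariant. -/
theorem Module.End.exists_invariant_finrank_add_eq {F V : Type*} [Field F] [AddCommGroup V]
    [Module F V] [FiniteDimensional F V] (T : Module.End F V) (W : Submodule F (Module.Dual F V))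
    (hW : ∀ φ ∈ W, T.dualMap φ ∈ W) :
    ∃ U : Submodule F V, (∀ v ∈ U, T v ∈ U) ∧
      Module.finrank F W + Module.finrank F U = Module.finrank F V := by
  refine ⟨W.dualCoannihilator, fun v hv ↦ ?_, Subspace.finrank_add_finrank_dualCoannihilator_eq W⟩
  rw [Submodule.mem_dualCoannihilator] at hv ⊢
  exact fun φ hφ ↦ hv _ (hW φ hφ)

open Polynomial in
theorem Module.End.exists_invariant_finrank_eq_natDegree_add {F V : Type*} [Field F]
    [AddCommGroup V] [Module F V] [FiniteDimensional F V] (T : Module.End F V) {f g : F[X]}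
    (hf : Irreducible f) (hg : Irreducible g) (hfg : IsCoprime f g)
    (hkf : LinearMap.ker (aeval T f) ≠ ⊥) (hkg : LinearMap.ker (aeval T g) ≠ ⊥) :
    ∃ U : Submodule F V, (∀ v ∈ U, T v ∈ U) ∧
      Module.finrank F U = f.natDegree + g.natDegree := by
  obtain ⟨U, hU, hTU, hdU⟩ := T.exists_invariant_finrank_eq_natDegree hf hkf
  obtain ⟨W, hW, hTW, hdW⟩ := T.exists_invariant_finrank_eq_natDegree hg hkg
  refine ⟨U ⊔ W, fun v hv ↦ ?_, ?_⟩
  · obtain ⟨u, hu, w, hw, rfl⟩ := Submodule.mem_sup.1 hv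
    rw [map_add]
    exact Submodule.add_mem_sup (hTU u hu) (hTW w hw)
  · have hdis : Disjoint U W := (Polynomial.disjoint_ker_aeval_of_isCoprime T hfg).mono hU hW
    rw [← hdU, ← hdW, ← Submodule.finrank_sup_add_finrank_inf_eq U W, hdis.eq_bot, finrank_bot,
      add_zero]

/-- A finite separable extension maps to a finite algebra as soon as it maps to each of its residue
fields. -/
theorem Algebra.nonempty_algHom_of_finrank_dvd_residueField {F K A : Type*} [Field F] [Field K]
    [Algebra F K] [Algebra.IsSeparable F K] [CommRing A] [Algebra F A] [Finite A]
    (h : ∀ M : Ideal A, M.IsMaximal → Module.finrank F K ∣ Module.finrank F (A ⧸ M)) :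
    Nonempty (K →ₐ[F] A) := by
  have hres (M : MaximalSpectrum A) : Nonempty (K →ₐ[F] A ⧸ M.asIdeal) := by
    let := Ideal.Quotient.field M.asIdeal
    have : Finite (A ⧸ M.asIdeal) := Finite.of_surjective _ Ideal.Quotient.mk_surjective
    exact FiniteField.nonempty_algHom_of_finrank_dvd (h M.asIdeal M.isMaximal)
  have := Algebra.FormallyEtale.of_isSeparable F K
  exact ⟨Algebra.FormallySmooth.lift (nilradical A) (IsNoetherianRing.isNilpotent_nilradical A)
    ((((IsArtinianRing.quotNilradicalEquivPi A).restrictScalars F).symm : _ →ₐ[F] _).comp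
      (AlgHom.pi fun M ↦ (hres M).some))⟩

open Polynomial in
theorem Polynomial.dvd_finrank_quotient_of_isMaximal {F : Type*} [Field F] {m : F[X]} {d : ℕ}
    (hm : m ≠ 0) (h : ∀ f, Irreducible f → f ∣ m → d ∣ f.natDegree)
    (M : Ideal (F[X] ⧸ Ideal.span {m})) (hM : M.IsMaximal) :
    d ∣ Module.finrank F ((F[X] ⧸ Ideal.span {m}) ⧸ M) := by
  let π := Ideal.Quotient.mkₐ F (Ideal.span {m})
  let ψ : F[X] →ₐ[F] ((F[X] ⧸ Ideal.span {m}) ⧸ M) := (Ideal.Quotient.mkₐ F M).comp π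
  have hψ : Function.Surjective ψ :=
    (Ideal.Quotient.mkₐ_surjective F M).comp (Ideal.Quotient.mkₐ_surjective F _)
  obtain ⟨f, hf⟩ := (IsPrincipalIdealRing.principal (RingHom.ker ψ)).principal
  have hf' : RingHom.ker ψ = Ideal.span {f} := hf
  have hmk : m ∈ RingHom.ker ψ := by
    have h0 : π m = 0 := Ideal.Quotient.eq_zero_iff_mem.2 (Ideal.mem_span_singleton_self m)
    rw [RingHom.mem_ker]
    change Ideal.Quotient.mkₐ F M (π m) = 0
    rw [h0, map_zero]
  have hfm : f ∣ m := by rwa [hf', Ideal.mem_span_singleton] at hmk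
  have hf0 : f ≠ 0 := ne_zero_of_dvd_ne_zero hm hfm
  have hprime : (RingHom.ker ψ).IsPrime := RingHom.ker_isPrime ψ
  have hirr : Irreducible f := by
    rw [hf', Ideal.span_singleton_prime hf0] at hprime
    exact hprime.irreducible
  have e := (Ideal.quotientKerAlgEquivOfSurjective hψ).toLinearEquiv.finrank_eq
  rw [← e, (Ideal.quotientEquivAlgOfEq F hf').toLinearEquiv.finrank_eq,
    finrank_quotient_span_eq_natDegree]
  exact h f hirr hfm

open Polynomial in
theorem ExtScalarStructure.nonempty_of_dvd_natDegree {F V : Type*} [Field F] [Fintype F]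
    [AddCommGroup V] [Module F V] [FiniteDimensional F V] (T : Module.End F V) {d : ℕ}
    (hd : d ≠ 0) (h : ∀ f, Irreducible f → f ∣ minpoly F T → d ∣ f.natDegree) :
    Nonempty (ExtScalarStructure (Fintype.card F ^ d) F V T) := by
  have hint : IsIntegral F T := Algebra.IsIntegral.isIntegral T
  have hm0 := minpoly.ne_zero hint
  obtain ⟨p, hp⟩ := CharP.exists F
  have : Fact p.Prime := ⟨CharP.char_is_prime F p⟩
  have : NeZero d := ⟨hd⟩
  let K := FiniteField.Extension F p d
  let A := F[X] ⧸ Ideal.span {minpoly F T}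
  have : Module.Finite F A := (minpoly.monic hint).finite_quotient
  have : Finite A := Module.finite_of_finite F
  have hK : Module.finrank F K = d := FiniteField.finrank_extension F p d
  obtain ⟨φ⟩ : Nonempty (K →ₐ[F] A) := Algebra.nonempty_algHom_of_finrank_dvd_residueField
    fun M hM ↦ hK.symm ▸ dvd_finrank_quotient_of_isMaximal hm0 h M hM
  let ev : A →ₐ[F] Module.End F V := Ideal.Quotient.liftₐ _ (aeval T) fun a ha ↦ by
    obtain ⟨b, rfl⟩ := Ideal.mem_span_singleton.1 ha
    rw [map_mul, minpoly.aeval, zero_mul]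
  let θ : K →ₐ[F] Module.End F V := ev.comp φ
  let : Module K V := Module.compHom V θ.toRingHom
  have hsmul (c : K) (v : V) : c • v = θ c v := rfl
  let : Fintype K := Fintype.ofFinite K
  refine ⟨{ K := K, cardK := ?_, ι := algebraMap F K, compat := ?_, linearX := ?_ }⟩
  · rw [← Nat.card_eq_fintype_card, FiniteField.natCard_extension, Nat.card_eq_fintype_card]
  · intro c v
    rw [hsmul, θ.commutes, Module.algebraMap_end_apply]
  · intro c v
    have hT : T = ev (Ideal.Quotient.mk _ X) := (aeval_X T).symm
    have hcomm : T * θ c = θ c * T := by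
      rw [hT]
      change ev _ * ev _ = ev _ * ev _
      rw [← map_mul, ← map_mul, mul_comm]
    exact LinearMap.congr_fun hcomm v

/-- Passing from a subspace to a complementary-dimensional one if necessary, an invariant subspace
of dimension prime to two distinct prime divisors of `n` can be taken of dimension `< n / 2`. -/
theorem exists_invariant_lt_half {n p₁ p₂ : ℕ} (hp₁ : p₁.Prime) (hp₂ : p₂.Prime) (hne : p₁ ≠ p₂)
    (hp₁n : p₁ ∣ n) (hp₂n : p₂ ∣ n) {F V : Type*} [Field F] [AddCommGroup V] [Module F V]
    [FiniteDimensional F V] (hV : Module.finrank F V = n) (T : Module.End F V) {k : ℕ}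
    (hk₁ : ¬ p₁ ∣ k) (hk₂ : ¬ p₂ ∣ k)
    (hU : ∃ U : Submodule F V, (∀ v ∈ U, T v ∈ U) ∧ Module.finrank F U = k)
    (hW : ∃ W : Submodule F (Module.Dual F V), (∀ φ ∈ W, T.dualMap φ ∈ W) ∧
      Module.finrank F W = k) :
    ∃ U : Submodule F V,
      1 ≤ Module.finrank F U ∧ (Module.finrank F U : ℚ) < (n : ℚ) / 2 ∧
      ¬ p₁ ∣ Module.finrank F U ∧ ¬ p₂ ∣ Module.finrank F U ∧ ∀ v ∈ U, T v ∈ U := by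
  have hhalf : ∀ j : ℕ, ¬ p₁ ∣ j → ¬ p₂ ∣ j → n ≠ 2 * j := by
    rintro j h₁ h₂ rfl
    have h₁' := (Nat.prime_dvd_prime_iff_eq hp₁ Nat.prime_two).1
      ((hp₁.dvd_mul.1 hp₁n).resolve_right h₁)
    have h₂' := (Nat.prime_dvd_prime_iff_eq hp₂ Nat.prime_two).1
      ((hp₂.dvd_mul.1 hp₂n).resolve_right h₂)
    exact hne (h₁'.trans h₂'.symm)
  have key : ∀ U : Submodule F V, (∀ v ∈ U, T v ∈ U) → ¬ p₁ ∣ Module.finrank F U →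
      ¬ p₂ ∣ Module.finrank F U → 2 * Module.finrank F U < n → ∃ U : Submodule F V,
      1 ≤ Module.finrank F U ∧ (Module.finrank F U : ℚ) < (n : ℚ) / 2 ∧
      ¬ p₁ ∣ Module.finrank F U ∧ ¬ p₂ ∣ Module.finrank F U ∧ ∀ v ∈ U, T v ∈ U := by
    intro U hTU h₁ h₂ hlt
    refine ⟨U, Nat.one_le_iff_ne_zero.2 fun h0 ↦ h₁ (h0 ▸ dvd_zero _), ?_, h₁, h₂, hTU⟩
    rw [lt_div_iff₀ two_pos, mul_comm]
    exact_mod_cast hlt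
  obtain ⟨U, hTU, hdU⟩ := hU
  obtain ⟨W, hTW, hdW⟩ := hW
  rcases lt_or_gt_of_ne (hhalf k hk₁ hk₂) with hlt | hgt
  · obtain ⟨U', hTU', hadd⟩ := T.exists_invariant_finrank_add_eq W hTW
    rw [hdW, hV] at hadd
    refine key U' hTU' (fun h ↦ hk₁ ?_) (fun h ↦ hk₂ ?_) (by omega)
    · exact (Nat.dvd_add_left h).1 (hadd ▸ hp₁n)
    · exact (Nat.dvd_add_left h).1 (hadd ▸ hp₂n)
  · exact key U hTU (hdU ▸ hk₁) (hdU ▸ hk₂) (hdU.symm ▸ hgt)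


theorem normal_covering_two_primes
    (n q p₁ p₂ : ℕ) (hn : 0 < n) (hq : IsPrimePow q)
    (hp₁ : p₁.Prime) (hp₂ : p₂.Prime) (hne : p₁ ≠ p₂) (hp₁n : p₁ ∣ n) (hp₂n : p₂ ∣ n)
    (F : Type*) [Field F] [Fintype F] (hF : Fintype.card F = q)
    (X : (Fin n → F) ≃ₗ[F] (Fin n → F)) :
    (∃ U : Submodule F (Fin n → F),
        1 ≤ Module.finrank F U ∧ (Module.finrank F U : ℚ) < (n : ℚ) / 2 ∧
        ¬ p₁ ∣ Module.finrank F U ∧ ¬ p₂ ∣ Module.finrank F U ∧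
        ∀ v ∈ U, X v ∈ U) ∨
      Nonempty (ExtScalarStructure (q ^ p₁) F (Fin n → F) ⇑X) ∨
      Nonempty (ExtScalarStructure (q ^ p₂) F (Fin n → F) ⇑X) := by
  subst hF
  let T : Module.End F (Fin n → F) := X
  have hV : Module.finrank F (Fin n → F) = n := by simp
  have hker {f : Polynomial F} (hf : Irreducible f) (hd : f ∣ minpoly F T) :=
    T.ker_aeval_ne_bot_of_dvd_minpoly hf hd
  have hkerD {f : Polynomial F} (hf : Irreducible f) (hd : f ∣ minpoly F T) :
      LinearMap.ker (Polynomial.aeval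
        (T.dualMap : Module.End F (Module.Dual F (Fin n → F))) f) ≠ ⊥ := by
    rw [LinearMap.aeval_dualMap]
    exact LinearMap.ker_dualMap_ne_bot _ (hker hf hd)
  by_cases h₁ : ∀ f, Irreducible f → f ∣ minpoly F T → p₁ ∣ f.natDegree
  · exact Or.inr (Or.inl (ExtScalarStructure.nonempty_of_dvd_natDegree T hp₁.ne_zero h₁))
  by_cases h₂ : ∀ f, Irreducible f → f ∣ minpoly F T → p₂ ∣ f.natDegree
  · exact Or.inr (Or.inr (ExtScalarStructure.nonempty_of_dvd_natDegree T hp₂.ne_zero h₂))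
  left
  push Not at h₁ h₂
  obtain ⟨f, hf, hfm, hf₁⟩ := h₁
  obtain ⟨g, hg, hgm, hg₂⟩ := h₂
  have single {f : Polynomial F} (hf : Irreducible f) (hfm : f ∣ minpoly F T)
      (hf₁ : ¬ p₁ ∣ f.natDegree) (hf₂ : ¬ p₂ ∣ f.natDegree) :=
    exists_invariant_lt_half hp₁ hp₂ hne hp₁n hp₂n hV T hf₁ hf₂
      ((T.exists_invariant_finrank_eq_natDegree hf (hker hf hfm)).imp fun _ h ↦ h.2)
      ((Module.End.exists_invariant_finrank_eq_natDegree _ hf (hkerD hf hfm)).imp fun _ h ↦ h.2)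
  by_cases hf₂ : p₂ ∣ f.natDegree
  swap
  · exact single hf hfm hf₁ hf₂
  by_cases hg₁ : p₁ ∣ g.natDegree
  swap
  · exact single hg hgm hg₁ hg₂
  have hfg : IsCoprime f g := (hf.coprime_iff_not_dvd).2 fun hdvd ↦ by
    have := Polynomial.natDegree_eq_of_degree_eq
      (Polynomial.degree_eq_degree_of_associated (hf.associated_of_dvd hg hdvd))
    exact hf₁ (this ▸ hg₁)
  exact exists_invariant_lt_half hp₁ hp₂ hne hp₁n hp₂n hV T (k := f.natDegree + g.natDegree)
    (fun h ↦ hf₁ ((Nat.dvd_add_left hg₁).1 h)) (fun h ↦ hg₂ ((Nat.dvd_add_right hf₂).1 h))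
    (T.exists_invariant_finrank_eq_natDegree_add hf hg hfg (hker hf hfm) (hker hg hgm))
    (Module.End.exists_invariant_finrank_eq_natDegree_add _ hf hg hfg (hkerD hf hfm)
      (hkerD hg hgm))
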